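/- Let G be a finite simple graph with α(G) = k ≥ 4 whose maximum independent set I is unique, let v ∈ I have MDI conditions in G, and suppose G contains no induced copy of the path P_5 whose center vertex is mapped to v. Then either (a) there exist distinct u, w ∈ I ∖ {v} for which one of the three conclusions of the α = 3 structure theorem holds (an induced complement of a cycle within N = {x ∈ N(v) : x ∼ u, x ∼ w}, or within N together with one vertex of Q = {x ∈ N(v) : x adjacent to exactly one of u, w}, or an induced complement of a path within N together with two vertices of Q as the endpoints), or (b) every vertex of N(v) is adjacent to at most two elements of I ∖ {v}. -/

import Mathlib

open SimpleGraph Finset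

variable {V : Type*}

/-- The number of neighbours of `x` inside the vertex set `A`
(i.e. the degree of `x` towards `A`, which for `x ∈ A` is its degree
in the subgraph induced on `A`). -/
noncomputable def degIn (G : SimpleGraph V) (A : Finset V) (x : V) : ℕ :=
  {y ∈ (A : Set V) | G.Adj x y}.ncard

/-- `s` is an independent set of vertices: pairwise nonadjacent. -/
def IsIndepF (G : SimpleGraph V) (s : Finset V) : Prop :=
  ∀ a ∈ s, ∀ b ∈ s, ¬ G.Adj a b

/-- The independence number of the subgraph of `G` induced on `A`:
the maximum size of an independent set contained in `A`. -/
noncomputable def indepNumOn (G : SimpleGraph V) (A : Finset V) : ℕ :=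
  sSup {n | ∃ s : Finset V, s ⊆ A ∧ IsIndepF G s ∧ s.card = n}

/-- `s` is a maximum independent set of the subgraph of `G` induced on `A`. -/
def MaxIndepOn (G : SimpleGraph V) (A s : Finset V) : Prop :=
  s ⊆ A ∧ IsIndepF G s ∧ s.card = indepNumOn G A

/-- `v` has MDI conditions in the subgraph of `G` induced on `A`:
`v` has maximum degree there and belongs to every maximum independent set. -/
def MDIOn (G : SimpleGraph V) (A : Finset V) (v : V) : Prop :=
  v ∈ A ∧ (∀ y ∈ A, degIn G A y ≤ degIn G A v) ∧
    ∀ s : Finset V, MaxIndepOn G A s → v ∈ s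

/-- The trichotomy conclusion of the `α = 3` structure theorem, relative to a vertex
`v` with MDI conditions and the two other vertices `u, w` of the maximum independent
set.  Here `N` is the set of common neighbours of `v`, `u`, `w` inside `N(v)`, and `Q`
is the set of vertices of `N(v)` adjacent to exactly one of `u, w`:
(1) some `N' ⊆ N` induces the complement of a cycle `C_n`, `n ≥ 3`; or
(2) some `N' ⊆ N` together with one vertex `q ∈ Q` induces the complement of a cycle
`C_n`, `n ≥ 3`; or
(3) some `N' ⊆ N` together with two distinct vertices `q₁, q₂ ∈ Q` induces the
complement of a path `P_n`, via an isomorphism sending `q₁`, `q₂` to the two endpoints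
of the path. -/
def StructureConclusion (G : SimpleGraph V) (v u w : V) : Prop :=
  (∃ N' : Set V, (∀ x ∈ N', G.Adj v x ∧ G.Adj u x ∧ G.Adj w x) ∧
      ∃ n : ℕ, Nonempty (G.induce N' ≃g (cycleGraph (n + 3))ᶜ)) ∨
  (∃ q : V, G.Adj v q ∧ Xor' (G.Adj u q) (G.Adj w q) ∧
      ∃ N' : Set V, (∀ x ∈ N', G.Adj v x ∧ G.Adj u x ∧ G.Adj w x) ∧ q ∉ N' ∧
        ∃ n : ℕ, Nonempty (G.induce (insert q N') ≃g (cycleGraph (n + 3))ᶜ)) ∨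
  (∃ q₁ q₂ : V, q₁ ≠ q₂ ∧
      G.Adj v q₁ ∧ Xor' (G.Adj u q₁) (G.Adj w q₁) ∧
      G.Adj v q₂ ∧ Xor' (G.Adj u q₂) (G.Adj w q₂) ∧
      ∃ N' : Set V, (∀ x ∈ N', G.Adj v x ∧ G.Adj u x ∧ G.Adj w x) ∧ q₁ ∉ N' ∧ q₂ ∉ N' ∧
        ∃ n : ℕ, ∃ φ : G.induce (insert q₁ (insert q₂ N')) ≃g (pathGraph (n + 2))ᶜ,
          φ ⟨q₁, Set.mem_insert _ _⟩ = 0 ∧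
          φ ⟨q₂, Set.mem_insert_of_mem _ (Set.mem_insert _ _)⟩ = Fin.last (n + 1))

/-- In a finite nonempty graph all of whose vertices have two distinct neighbours there is an
injectively embedded (not necessarily induced) cycle. -/
theorem exists_injOn_cycle {W : Type*} [Finite W] [Nonempty W] (H : SimpleGraph W)
    (h : ∀ x, ∃ y z, y ≠ z ∧ H.Adj x y ∧ H.Adj x z) :
    ∃ n : ℕ, ∃ f : ℕ → W, (∀ i j, i < j → j ≤ n + 2 → f i ≠ f j) ∧
      (∀ i, H.Adj (f i) (f (i + 1))) ∧ H.Adj (f (n + 2)) (f 0) := by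
  classical
  have step : ∀ p : W × W, ∃ z, z ≠ p.1 ∧ H.Adj p.2 z := by
    rintro ⟨a, b⟩
    obtain ⟨y, z, hyz, hy, hz⟩ := h b
    by_cases hya : y = a
    · exact ⟨z, fun e => hyz (hya.trans e.symm), hz⟩
    · exact ⟨y, hya, hy⟩
  choose next hne hadj using step
  obtain ⟨a⟩ := ‹Nonempty W›
  obtain ⟨b, -, -, hab, -⟩ := h a
  let s : ℕ → W × W := fun n => (fun p => (p.2, next p))^[n] (a, b)
  have hs : ∀ n, s (n + 1) = ((s n).2, next (s n)) := fun n =>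
    Function.iterate_succ_apply' _ _ _
  have hs1 : ∀ n, (s (n + 1)).1 = (s n).2 := fun n => by rw [hs]
  have hA : ∀ n, H.Adj (s n).1 (s (n + 1)).1 := by
    intro n
    cases n with
    | zero => exact hab
    | succ n => rw [hs1 (n + 1), hs n]; exact hadj _
  have hB : ∀ n, (s (n + 2)).1 ≠ (s n).1 := by
    intro n
    rw [hs1 (n + 1), hs n]; exact hne _
  have hex : ∃ d : ℕ, 0 < d ∧ ∃ i, (s i).1 = (s (i + d)).1 := by
    obtain ⟨i, j, hij, he⟩ := Finite.exists_ne_map_eq_of_infinite fun n => (s n).1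
    rcases lt_or_gt_of_ne hij with hlt | hlt
    · exact ⟨j - i, by omega, i, by rw [Nat.add_sub_cancel' hlt.le]; exact he⟩
    · exact ⟨i - j, by omega, j, by rw [Nat.add_sub_cancel' hlt.le]; exact he.symm⟩
  have hmin := fun m => @Nat.find_min _ _ hex m
  obtain ⟨hpos, i, hi⟩ := Nat.find_spec hex
  generalize Nat.find hex = d at hmin hpos hi
  have h1 : d ≠ 1 := by
    rintro rfl
    exact (hA i).ne hi
  have h2 : d ≠ 2 := by
    rintro rfl
    exact hB i hi.symm
  obtain ⟨n, rfl⟩ : ∃ n, d = n + 3 := ⟨d - 3, by omega⟩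
  refine ⟨n, fun t => (s (i + t)).1, fun k l hkl hl he => ?_, fun k => hA (i + k), ?_⟩
  · refine hmin (l - k) (by omega) ⟨by omega, i + k, ?_⟩
    rw [show i + k + (l - k) = i + l by omega]; exact he
  · have := hA (i + (n + 2))
    rw [show i + (n + 2) + 1 = i + (n + 3) by omega, ← hi] at this
    exact this

theorem cycleGraph_adj_of_lt {n : ℕ} {i j : Fin (n + 3)} (hij : i < j) :
    (cycleGraph (n + 3)).Adj i j ↔ j.val = i.val + 1 ∨ i.val = 0 ∧ j.val = n + 2 := by
  rw [cycleGraph_adj', Fin.val_sub, Fin.val_sub]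
  have hlt : i.val < j.val := hij
  have hj := j.isLt
  rw [show n + 3 - i.val + j.val = (j.val - i.val) + (n + 3) by omega, Nat.add_mod_right,
    Nat.mod_eq_of_lt (show j.val - i.val < n + 3 by omega),
    Nat.mod_eq_of_lt (show n + 3 - j.val + i.val < n + 3 by omega)]
  omega

/-- A finite nonempty graph all of whose vertices have two distinct neighbours contains an
induced cycle. -/
theorem exists_cycleGraph_embedding {W : Type*} [Finite W] [Nonempty W] (H : SimpleGraph W)
    (h : ∀ x, ∃ y z, y ≠ z ∧ H.Adj x y ∧ H.Adj x z) :
    ∃ n : ℕ, Nonempty (cycleGraph (n + 3) ↪g H) := by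
  classical
  have hex : ∃ n : ℕ, ∃ f : ℕ → W, (∀ i j, i < j → j ≤ n + 2 → f i ≠ f j) ∧
      (∀ i, i < n + 2 → H.Adj (f i) (f (i + 1))) ∧ H.Adj (f (n + 2)) (f 0) := by
    obtain ⟨n, f, h1, h2, h3⟩ := exists_injOn_cycle H h
    exact ⟨n, f, h1, fun i _ => h2 i, h3⟩
  have hmin := fun m => @Nat.find_min _ _ hex m
  obtain ⟨f, hinj, hstep, hclose⟩ := Nat.find_spec hex
  generalize Nat.find hex = n at hmin hinj hstep hclose
  have hlt : ∀ i j : Fin (n + 3), i < j →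
      (H.Adj (f i) (f j) ↔ (cycleGraph (n + 3)).Adj i j) := by
    intro i j hij
    rw [cycleGraph_adj_of_lt hij]
    have hij' : i.val < j.val := hij
    have hj := j.isLt
    constructor
    · intro hadj
      by_contra hc
      refine hmin (j - i - 2) (by omega) ⟨fun t => f (i + t), fun k l hkl hl => ?_,
        fun k hk => hstep (i + k) (by omega), ?_⟩
      · exact hinj _ _ (by omega) (by omega)
      · change H.Adj (f (i + (j - i - 2 + 2))) (f i)
        rw [show i.val + (j.val - i.val - 2 + 2) = j.val by omega]
        exact hadj.symm
    · rintro (hs | ⟨h0, hl⟩)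
      · rw [hs]
        exact hstep i (by omega)
      · rw [h0, hl]
        exact hclose.symm
  refine ⟨n, ⟨⟨⟨fun i => f i, fun i j he => ?_⟩, fun {i j} => ?_⟩⟩⟩
  · rcases lt_trichotomy i j with hij | hij | hij
    · exact absurd he (hinj i j hij (by omega))
    · exact hij
    · exact absurd he.symm (hinj j i hij (by omega))
  · change H.Adj (f i) (f j) ↔ _
    rcases lt_trichotomy i j with hij | rfl | hij
    · exact hlt i j hij
    · simp
    · rw [H.adj_comm, (cycleGraph _).adj_comm]
      exact hlt j i hij

/-- The image of an induced copy of `C` in the complement of `G` induces the complement of `C`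
in `G`. -/
theorem exists_induce_iso_compl {C : Type*} {K : SimpleGraph C} {G : SimpleGraph V}
    (e : K ↪g Gᶜ) {S : Set V} (hS : Set.range e = S) :
    ∃ φ : G.induce S ≃g Kᶜ, ∀ (i : C) (h : e i ∈ S), φ ⟨e i, h⟩ = i := by
  subst hS
  have hadj : ∀ i j, Kᶜ.Adj i j ↔ G.Adj (e i) (e j) := by
    intro i j
    have h1 : Gᶜ.Adj (e i) (e j) ↔ K.Adj i j := e.map_rel_iff
    rw [compl_adj, ← h1, compl_adj, ← e.injective.ne_iff]
    constructor
    · tauto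
    · exact fun h => ⟨h.ne, fun h' => h'.2 h⟩
  let ψ : Kᶜ ≃g G.induce (Set.range e) :=
    ⟨Equiv.ofInjective e e.injective, fun {i j} => (hadj i j).symm⟩
  exact ⟨ψ.symm, fun i _ => ψ.symm_apply_apply i⟩

/-- Two nonempty proper subsets of a set can be simultaneously split by a pair of points. -/
theorem exists_pair_splitting {J A B : Set V} (hA : (A ∩ J).Nonempty) (hA' : ¬ J ⊆ A)
    (hB : (B ∩ J).Nonempty) (hB' : ¬ J ⊆ B) :
    ∃ u ∈ J, ∃ w ∈ J, u ≠ w ∧ Xor (u ∈ A) (w ∈ A) ∧ Xor (u ∈ B) (w ∈ B) := by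
  obtain ⟨a, ha, haJ⟩ := hA
  obtain ⟨b, hb, hbJ⟩ := hB
  obtain ⟨c, hcJ, hc⟩ := Set.not_subset.1 hA'
  obtain ⟨d, hdJ, hd⟩ := Set.not_subset.1 hB'
  have key : ∀ p ∈ J, ∀ q ∈ J, Xor (p ∈ A) (q ∈ A) → Xor (p ∈ B) (q ∈ B) →
      ∃ u ∈ J, ∃ w ∈ J, u ≠ w ∧ Xor (u ∈ A) (w ∈ A) ∧ Xor (u ∈ B) (w ∈ B) :=
    fun p hp q hq h1 h2 => ⟨p, hp, q, hq, by rintro rfl; exact (xor_self _).mp h1, h1, h2⟩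
  by_cases haB : a ∈ B
  · by_cases hcB : c ∈ B
    · by_cases hdA : d ∈ A
      · exact key c hcJ d hdJ (by simp [Xor, hc, hdA]) (by simp [Xor, hcB, hd])
      · exact key a haJ d hdJ (by simp [Xor, ha, hdA]) (by simp [Xor, haB, hd])
    · exact key a haJ c hcJ (by simp [Xor, ha, hc]) (by simp [Xor, haB, hcB])
  · by_cases hcB : c ∈ B
    · exact key a haJ c hcJ (by simp [Xor, ha, hc]) (by simp [Xor, haB, hcB])
    · by_cases hbA : b ∈ A
      · exact key b hbJ c hcJ (by simp [Xor, hbA, hc]) (by simp [Xor, hb, hcB])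
      · exact key a haJ b hbJ (by simp [Xor, ha, hbA]) (by simp [Xor, haB, hb])

theorem StructureConclusion.of_not_adj {G : SimpleGraph V} {v u w p q : V} (hpq : p ≠ q)
    (hnadj : ¬ G.Adj p q) (hp : G.Adj v p) (hq : G.Adj v q)
    (hp' : Xor (G.Adj u p) (G.Adj w p)) (hq' : Xor (G.Adj u q) (G.Adj w q)) :
    StructureConclusion G v u w := by
  let e : pathGraph 2 ↪g Gᶜ := ⟨⟨![p, q], by
      intro i j
      fin_cases i <;> fin_cases j <;> simp [hpq, hpq.symm]⟩, by
      intro i j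
      change Gᶜ.Adj (![p, q] i) (![p, q] j) ↔ _
      fin_cases i <;> fin_cases j <;>
        simp [pathGraph_adj, hpq, hpq.symm, hnadj, G.adj_comm q p]⟩
  have hrange : Set.range e = insert p (insert q ∅) := by
    ext x
    change (∃ i, ![p, q] i = x) ↔ _
    simp [Fin.exists_fin_two, eq_comm]
  obtain ⟨φ, hφ⟩ := exists_induce_iso_compl e hrange
  exact .inr <| .inr ⟨p, q, hpq, hp, hp', hq, hq', ∅, by simp, by simp, by simp, 0, φ,
    hφ 0 _, hφ 1 _⟩

theorem StructureConclusion.of_not_adj_of_not_adj {G : SimpleGraph V} {v u w p y q : V}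
    (hpq : p ≠ q) (hpy : p ≠ y) (hyq : y ≠ q) (hnpy : ¬ G.Adj p y) (hnyq : ¬ G.Adj y q)
    (hadj : G.Adj p q) (hp : G.Adj v p) (hq : G.Adj v q)
    (hp' : Xor (G.Adj u p) (G.Adj w p)) (hq' : Xor (G.Adj u q) (G.Adj w q))
    (hy : G.Adj v y ∧ G.Adj u y ∧ G.Adj w y) :
    StructureConclusion G v u w := by
  let e : pathGraph 3 ↪g Gᶜ := ⟨⟨![p, y, q], by
      intro i j
      fin_cases i <;> fin_cases j <;> simp [hpq, hpq.symm, hpy, hpy.symm, hyq, hyq.symm]⟩, by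
      intro i j
      change Gᶜ.Adj (![p, y, q] i) (![p, y, q] j) ↔ _
      fin_cases i <;> fin_cases j <;>
        simp [pathGraph_adj, hpq, hpq.symm, hpy, hpy.symm, hyq, hyq.symm, hadj, hadj.symm,
          hnpy, hnyq, G.adj_comm y p, G.adj_comm q y]⟩
  have hrange : Set.range e = insert p (insert q {y}) := by
    ext x
    change (∃ i, ![p, y, q] i = x) ↔ _
    simp [Fin.exists_fin_succ, eq_comm]
    tauto
  obtain ⟨φ, hφ⟩ := exists_induce_iso_compl e hrange
  refine .inr <| .inr ⟨p, q, hpq, hp, hp', hq, hq', {y}, ?_, hpy, hyq.symm, 1, φ,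
    hφ 0 _, hφ 2 _⟩
  rintro x rfl
  exact hy

/-- A vertex adjacent to a vertex `v` of maximum degree misses at least as many vertices of `N(v)`
as it has neighbours in any set disjoint from the closed neighbourhood of `v`. -/
theorem card_le_card_nonadj_of_degIn_le [Fintype V] [DecidableEq V] {G : SimpleGraph V}
    [DecidableRel G.Adj] {v x : V} (hdeg : degIn G univ x ≤ degIn G univ v) (hx : G.Adj v x)
    {A : Finset V} (hvA : v ∉ A) (hA : ∀ y ∈ A, ¬ G.Adj v y) (hxA : ∀ y ∈ A, G.Adj x y) :
    #A ≤ #{y | G.Adj v y ∧ x ≠ y ∧ ¬ G.Adj x y} := by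
  have hd : ∀ z, degIn G univ z = #{y | G.Adj z y} := by
    intro z
    rw [degIn, ← Set.ncard_coe_finset]
    simp
  rw [hd, hd] at hdeg
  have hsplit : #{y | G.Adj v y} = #{y | G.Adj v y ∧ x ≠ y ∧ ¬ G.Adj x y} +
      (#{y | G.Adj v y ∧ G.Adj x y} + 1) := by
    rw [← card_insert_of_notMem (show x ∉ ({y | G.Adj v y ∧ G.Adj x y} : Finset V) by simp),
      ← card_union_of_disjoint]
    · congr 1
      ext y
      by_cases hxy : x = y
      · subst hxy; simp [hx]
      · simp [hxy, Ne.symm hxy]; tauto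
    · rw [Finset.disjoint_left]
      intro y hy hy'
      simp only [mem_filter, mem_univ, true_and, mem_insert] at hy hy'
      rcases hy' with rfl | hy'
      · exact hy.2.1 rfl
      · exact hy.2.2 hy'.2
  have hsub : insert v (A ∪ ({y | G.Adj v y ∧ G.Adj x y} : Finset V)) ⊆
      ({y | G.Adj x y} : Finset V) := by
    intro y hy
    simp only [mem_filter, mem_univ, true_and, mem_insert, mem_union] at hy ⊢
    rcases hy with rfl | hy | hy
    · exact hx.symm
    · exact hxA y hy
    · exact hy.2
  have hcard := card_le_card hsub
  rw [card_insert_of_notMem (by simp [hvA]), card_union_of_disjoint] at hcard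
  · omega
  · rw [Finset.disjoint_left]
    intro y hy hy'
    simp only [mem_filter, mem_univ, true_and] at hy'
    exact hA y hy hy'.1

/-- If `v` lies in every maximum independent set, then each neighbour of `v` has another neighbour
in any maximum independent set. -/
theorem exists_adj_of_forall_maxIndepOn_mem [Fintype V] {G : SimpleGraph V} {I : Finset V} {v x : V}
    (hI : MaxIndepOn G univ I) (hv : ∀ s, MaxIndepOn G univ s → v ∈ s) (hx : G.Adj v x) :
    ∃ y ∈ I, y ≠ v ∧ G.Adj x y := by
  classical
  by_contra! hc
  have hvI := hv I hI
  have hxI : x ∉ I := fun h => hI.2.1 v hvI x h hx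
  have hmem := hv (insert x (I.erase v)) ⟨subset_univ _, ?_, ?_⟩
  · simp [hx.ne] at hmem
  · intro a ha b hb
    simp only [mem_insert, mem_erase] at ha hb
    rcases ha with rfl | ha <;> rcases hb with rfl | hb
    · simp
    · exact hc b hb.2 hb.1
    · exact fun h => hc a ha.2 ha.1 h.symm
    · exact hI.2.1 a ha.2 b hb.2
  · rw [card_insert_of_notMem (by simp [hxI]), card_erase_add_one hvI]
    exact hI.2.2

/-- if the maximum independent set `I` of `G` is unique with
`|I| = k ≥ 4`, `v ∈ I` has MDI conditions, and `G` has no induced `P₅` centered at `v`,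
then either (a) the structure trichotomy holds for some distinct `u, w ∈ I \ {v}`, or
(b) every vertex of `N(v)` is adjacent to at most two elements of `I \ {v}`. -/
theorem structure_or_bounded_attachment [Fintype V] (G : SimpleGraph V)
    (I : Finset V) (v : V)
    (hI : MaxIndepOn G Finset.univ I)
    (huniq : ∀ J : Finset V, MaxIndepOn G Finset.univ J → J = I)
    (hcard : 4 ≤ I.card) (hvI : v ∈ I)
    (hMDI : MDIOn G Finset.univ v)
    (hP5 : ¬ ∃ f : pathGraph 5 ↪g G, f (2 : Fin 5) = v) :
    (∃ u ∈ I, ∃ w ∈ I, u ≠ v ∧ w ≠ v ∧ u ≠ w ∧ StructureConclusion G v u w) ∨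
      (∀ x : V, G.Adj v x → {y : V | y ∈ I ∧ y ≠ v ∧ G.Adj x y}.ncard ≤ 2) := by
  classical
  refine or_iff_not_imp_left.2 fun hno => ?_
  push Not at hno
  obtain ⟨-, hmax, hall⟩ := hMDI
  have hJ : ∀ y, y ∈ I.erase v ↔ y ≠ v ∧ y ∈ I := fun y => mem_erase
  have hnadj : ∀ y ∈ I.erase v, ¬ G.Adj v y := fun y hy => hI.2.1 v hvI y (mem_of_mem_erase hy)
  have hJcard : 3 ≤ #(I.erase v) := by
    rw [card_erase_of_mem hvI]; omega
  have hsplit : ∀ p q, G.Adj v p → G.Adj v q → (¬ ∀ y ∈ I.erase v, G.Adj y p) →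
      (¬ ∀ y ∈ I.erase v, G.Adj y q) → ∃ u ∈ I.erase v, ∃ w ∈ I.erase v, u ≠ w ∧
        Xor (G.Adj u p) (G.Adj w p) ∧ Xor (G.Adj u q) (G.Adj w q) := by
    have hne : ∀ p, G.Adj v p → ({y | G.Adj y p} ∩ (I.erase v : Set V)).Nonempty := by
      intro p hp
      obtain ⟨y, hy, hyv, hadj⟩ := exists_adj_of_forall_maxIndepOn_mem hI hall hp
      exact ⟨y, hadj.symm, mem_coe.2 ((hJ y).2 ⟨hyv, hy⟩)⟩
    exact fun p q hp hq hp' hq' => exists_pair_splitting (hne p hp) hp' (hne q hq) hq'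
  have hno' : ∀ u ∈ I.erase v, ∀ w ∈ I.erase v, u ≠ w → ¬ StructureConclusion G v u w :=
    fun u hu w hw => hno u ((hJ u).1 hu).2 w ((hJ w).1 hw).2 ((hJ u).1 hu).1 ((hJ w).1 hw).1
  let F : Set V := {x | G.Adj v x ∧ ∀ y ∈ I.erase v, G.Adj y x}
  have hedge : ∀ p q, G.Adj v p → G.Adj v q → p ≠ q → ¬ G.Adj p q → p ∉ F → q ∈ F := by
    intro p q hp hq hpq hn hpF
    by_contra hqF
    obtain ⟨u, hu, w, hw, huw, h1, h2⟩ := hsplit p q hp hq (fun h => hpF ⟨hp, h⟩)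
      (fun h => hqF ⟨hq, h⟩)
    exact hno' u hu w hw huw (.of_not_adj hpq hn hp hq h1 h2)
  have hfull : ∀ x ∈ F, ∃ y ∈ F, ∃ z ∈ F, y ≠ z ∧ Gᶜ.Adj x y ∧ Gᶜ.Adj x z := by
    intro x hx
    have hcard := card_le_card_nonadj_of_degIn_le (hmax x (mem_univ x)) hx.1
      (notMem_erase v I) hnadj fun y hy => (hx.2 y hy).symm
    set S : Finset V := {y | G.Adj v y ∧ x ≠ y ∧ ¬ G.Adj x y} with hS
    have hle : #{y ∈ S | y ∉ F} ≤ 1 := by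
      rw [card_le_one]
      intro p hp q hq
      simp only [hS, mem_filter, mem_univ, true_and] at hp hq
      obtain ⟨⟨hvp, hxp, hnxp⟩, hpF⟩ := hp
      obtain ⟨⟨hvq, hxq, hnxq⟩, hqF⟩ := hq
      by_contra hpq
      have hadj : G.Adj p q := by
        by_contra hn
        exact hqF (hedge p q hvp hvq hpq hn hpF)
      obtain ⟨u, hu, w, hw, huw, h1, h2⟩ := hsplit p q hvp hvq (fun h => hpF ⟨hvp, h⟩)
        (fun h => hqF ⟨hvq, h⟩)
      exact hno' u hu w hw huw (.of_not_adj_of_not_adj hpq hxp.symm hxq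
        (fun h => hnxp h.symm) hnxq hadj hvp hvq h1 h2 ⟨hx.1, hx.2 u hu, hx.2 w hw⟩)
    have hadd := card_filter_add_card_filter_not (s := S) (· ∈ F)
    obtain ⟨y, hy, z, hz, hyz⟩ := one_lt_card.1 (show 1 < #{y ∈ S | y ∈ F} by omega)
    simp only [hS, mem_filter, mem_univ, true_and] at hy hz
    exact ⟨y, hy.2, z, hz.2, hyz, hy.1.2, hz.1.2⟩
  have hF : F = ∅ := by
    by_contra hF
    have : Nonempty F := (Set.nonempty_iff_ne_empty.2 hF).to_subtype
    obtain ⟨n, ⟨e⟩⟩ := exists_cycleGraph_embedding (Gᶜ.induce F) (by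
      rintro ⟨x, hx⟩
      obtain ⟨y, hy, z, hz, hyz, h1, h2⟩ := hfull x hx
      exact ⟨⟨y, hy⟩, ⟨z, hz⟩, fun h => hyz (congrArg Subtype.val h), h1, h2⟩)
    obtain ⟨u, hu, w, hw, huw⟩ := one_lt_card.1 (show 1 < #(I.erase v) by omega)
    let e' : cycleGraph (n + 3) ↪g Gᶜ := (Embedding.induce F).comp e
    obtain ⟨φ, -⟩ := exists_induce_iso_compl e' rfl
    refine hno' u hu w hw huw (.inl ⟨Set.range e', ?_, n, ⟨φ⟩⟩)
    rintro _ ⟨i, rfl⟩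
    have hi : e' i ∈ F := (e i).2
    exact ⟨hi.1, hi.2 u hu, hi.2 w hw⟩
  intro x hx
  exfalso
  obtain ⟨y, hy, hyv, hxy⟩ := exists_adj_of_forall_maxIndepOn_mem hI hall hx
  have hcard := card_le_card_nonadj_of_degIn_le (A := {y}) (hmax x (mem_univ x)) hx
    (by simpa using hyv.symm) (by simpa using hI.2.1 v hvI y hy) (by simpa using hxy)
  obtain ⟨z, hz⟩ := card_pos.1 (lt_of_lt_of_le (by simp) hcard)
  simp only [mem_filter, mem_univ, true_and] at hz
  have := hedge x z hx hz.1 hz.2.1 hz.2.2 (by simp [hF])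
  simp [hF] at this
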